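/- Let G be a finite simple graph with mad(G) < 18/7 and ch_3^d(G) > 6 such that every proper subgraph H of G (obtained from G by deleting at least one vertex or at least one edge) satisfies ch_3^d(H) ≤ 6. If x ∈ W_3(G) and y is a weak neighbor of x, then y ∈ W_1(G); consequently x has three distinct weak neighbors, all lying in W_1(G). -/

import Mathlib

open SimpleGraph

/-- `φ` is a proper coloring of `G` that is 3-dynamic: every vertex `v` sees at least
`min 3 (deg v)` distinct colors on its neighborhood. -/
def IsDyn3Coloring {V : Type*} (G : SimpleGraph V) (φ : V → ℕ) : Prop :=
  (∀ u v, G.Adj u v → φ u ≠ φ v) ∧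
  ∀ v, min 3 (G.neighborSet v).ncard ≤ (φ '' G.neighborSet v).ncard

/-- `G` is 3-dynamically colorable from the list assignment `L`. -/
def Dyn3ListColorable {V : Type*} (G : SimpleGraph V) (L : V → Finset ℕ) : Prop :=
  ∃ φ : V → ℕ, IsDyn3Coloring G φ ∧ ∀ v, φ v ∈ L v

/-- `ch_3^d(G) ≤ k` : `G` is 3-dynamically `L`-colorable for every list assignment `L`
with `|L v| ≥ k` for all `v`. -/
def Ch3dLE {V : Type*} (G : SimpleGraph V) (k : ℕ) : Prop :=
  ∀ L : V → Finset ℕ, (∀ v, k ≤ (L v).card) → Dyn3ListColorable G L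

/-- `mad(G) < c` : every nonempty subgraph has average degree `< c`. -/
def MadLT {V : Type*} (G : SimpleGraph V) (c : ℚ) : Prop :=
  ∀ H : G.Subgraph, H.verts.Nonempty →
    (2 * H.edgeSet.ncard : ℚ) / (H.verts.ncard : ℚ) < c

/-- `mad(G) ≤ c` : every nonempty subgraph has average degree `≤ c`. -/
def MadLE {V : Type*} (G : SimpleGraph V) (c : ℚ) : Prop :=
  ∀ H : G.Subgraph, H.verts.Nonempty →
    (2 * H.edgeSet.ncard : ℚ) / (H.verts.ncard : ℚ) ≤ c

/-- Every proper subgraph of `G` (deleting at least one vertex or edge) has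
`ch_3^d ≤ k`. -/
def ProperSubgraphsCh3dLE {V : Type*} (G : SimpleGraph V) (k : ℕ) : Prop :=
  ∀ H : G.Subgraph, H ≠ ⊤ → Ch3dLE H.coe k

/-- `x ∈ W_i(G)` : `x` has degree 3 and exactly `i` neighbors of degree 2. -/
def Wmem {V : Type*} (G : SimpleGraph V) (i : ℕ) (x : V) : Prop :=
  (G.neighborSet x).ncard = 3 ∧
    {y | G.Adj x y ∧ (G.neighborSet y).ncard = 2}.ncard = i

/-- `y` is a weak neighbor of `x` : they are distinct and have a common neighbor of
degree 2. -/
def WeakAdj {V : Type*} (G : SimpleGraph V) (x y : V) : Prop :=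
  x ≠ y ∧ ∃ w, G.Adj x w ∧ G.Adj y w ∧ (G.neighborSet w).ncard = 2


section Aux

lemma aux_T {V : Type*} [DecidableEq V] (N S : Finset V) (φ : V → ℕ)
    (h : min 3 (N \ S).card ≤ ((N \ S).image φ).card) :
    ∃ T : Finset V, T ⊆ N ∧ T.card = min 3 N.card ∧ Set.InjOn φ (T \ S : Finset V) ∧
      (3 ≤ (N \ S).card → Disjoint T S) := by
  have hsub : (N \ S).card ≤ N.card := Finset.card_le_card Finset.sdiff_subset
  by_cases h3 : 3 ≤ (N \ S).card
  · rw [min_eq_left h3] at h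
    obtain ⟨U, hU, hUc⟩ := Finset.exists_subset_card_eq h
    obtain ⟨T, hT, hinj⟩ := Finset.subset_image_iff.1 hU |>.imp fun T hT => hT
    obtain ⟨T', hT', hb⟩ := (Set.surjOn_image φ (T : Set V)).exists_bijOn_subset
    have hfin : T'.Finite := T.finite_toSet.subset hT'
    lift T' to Finset V using hfin
    have hTT : T' ⊆ T := by exact_mod_cast hT'
    have him : T'.image φ = U := by
      rw [← hinj]
      exact_mod_cast hb.image_eq
    have hc : T'.card = 3 := by
      rw [← hUc, ← him, Finset.card_image_of_injOn hb.injOn]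
    have hTS : T' ⊆ N \ S := fun a ha => hT (hTT ha)
    refine ⟨T', hTS.trans Finset.sdiff_subset, ?_, hb.injOn.mono ?_, fun _ => ?_⟩
    · rw [hc]; omega
    · intro a ha; simp at ha; exact_mod_cast ha.1
    · rw [Finset.disjoint_left]
      intro a ha; exact (Finset.mem_sdiff.1 (hTS ha)).2
  · have hle : (N \ S).card ≤ min 3 N.card := by omega
    obtain ⟨T, h1, h2, h3'⟩ := Finset.exists_subsuperset_card_eq
      (Finset.sdiff_subset : N \ S ⊆ N) hle (min_le_right _ _)
    have hinj : Set.InjOn φ (N \ S : Finset V) := by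
      apply Finset.card_image_iff.1
      exact le_antisymm Finset.card_image_le (by omega)
    refine ⟨T, h2, h3', hinj.mono ?_, fun h => absurd h h3⟩
    exact_mod_cast Finset.sdiff_subset_sdiff h2 le_rfl

lemma aux_sdr {ι : Type*} [Fintype ι] [DecidableEq ι] (hι : Fintype.card ι = 4)
    (R : ι → Finset ℕ) (hR : ∀ i, 3 ≤ (R i).card)
    (hno : ¬ ∃ c : ι → ℕ, Function.Injective c ∧ ∀ i, c i ∈ R i) :
    ∃ U : Finset ℕ, U.card = 3 ∧ ∀ i, R i = U := by
  rw [← Finset.all_card_le_biUnion_card_iff_exists_injective] at hno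
  push Not at hno
  obtain ⟨s, hs⟩ := hno
  have hne : s.Nonempty := by
    by_contra h
    rw [Finset.not_nonempty_iff_eq_empty] at h
    simp [h] at hs
  obtain ⟨i, hi⟩ := hne
  have h3 : 3 ≤ (s.biUnion R).card :=
    (hR i).trans (Finset.card_le_card (Finset.subset_biUnion_of_mem R hi))
  have h4 : s.card ≤ 4 := hι ▸ Finset.card_le_univ s
  have hu : s = Finset.univ := by
    rw [← Finset.card_eq_iff_eq_univ]; omega
  refine ⟨s.biUnion R, by omega, fun j => ?_⟩
  apply Finset.eq_of_subset_of_card_le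
  · exact Finset.subset_biUnion_of_mem R (by simp [hu])
  · have := hR j; omega

lemma aux_toggle (L P : Finset ℕ) (hL : 6 ≤ L.card) (hP : P.card ≤ 2) (a b : ℕ) (hab : a ≠ b)
    (hc : (L \ insert a P).card = 3) (he : L \ insert a P = L \ insert b P) : False := by
  have h1 := Finset.card_inter_add_card_sdiff L (insert a P)
  have h2 : (L ∩ insert a P).card ≤ (insert a P).card := Finset.card_le_card Finset.inter_subset_right
  have h3 := Finset.card_insert_le a P
  have h4 : L ∩ insert a P = insert a P :=
    Finset.eq_of_subset_of_card_le Finset.inter_subset_right (by omega)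
  have h5 : a ∉ P := by
    intro h; rw [Finset.insert_eq_of_mem h] at h2 h1 hc; omega
  have h6 : a ∈ L := (Finset.mem_inter.1 (h4 ▸ Finset.mem_insert_self a P)).1
  have h7 : a ∈ L \ insert b P := by simp [h6, h5, hab]
  rw [← he] at h7
  simp at h7

structure Dyn3Good {V : Type*} [Fintype V] [DecidableEq V] (G : SimpleGraph V) [DecidableRel G.Adj]
    (L : V → Finset ℕ) (T : V → Finset V) (S : Finset V) (φ : V → ℕ) : Prop where
  sub : ∀ v, T v ⊆ G.neighborFinset v
  card : ∀ v, (T v).card = min 3 (G.neighborFinset v).card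
  inj : ∀ v a b, a ∈ T v → b ∈ T v → a ∉ S → b ∉ S → φ a = φ b → a = b
  proper : ∀ a b, a ∉ S → b ∉ S → G.Adj a b → φ a ≠ φ b
  list : ∀ a, a ∉ S → φ a ∈ L a

variable {V : Type*} [Fintype V] [DecidableEq V] {G : SimpleGraph V} [DecidableRel G.Adj]
  {L : V → Finset ℕ} {T : V → Finset V}

lemma Dyn3Good.T_eq {S : Finset V} {φ : V → ℕ} (h : Dyn3Good G L T S φ) (v : V)
    (hv : (G.neighborFinset v).card ≤ 3) : T v = G.neighborFinset v :=
  Finset.eq_of_subset_of_card_le (h.sub v) (by rw [h.card v, min_eq_right hv])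

lemma ncard_nbr (v : V) : (G.neighborSet v).ncard = (G.neighborFinset v).card := by
  rw [← Set.ncard_coe_finset]; simp

lemma Dyn3Good.colorable {φ : V → ℕ} (h : Dyn3Good G L T ∅ φ) : Dyn3ListColorable G L := by
  refine ⟨φ, ⟨fun u v huv => h.proper u v (by simp) (by simp) huv, fun v => ?_⟩,
    fun v => h.list v (by simp)⟩
  rw [ncard_nbr, ← h.card v]
  have h1 : (T v).card = ((T v).image φ).card := by
    rw [Finset.card_image_of_injOn]
    intro a ha b hb hab
    exact h.inj v a b ha hb (by simp) (by simp) hab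
  have h2 : φ '' G.neighborSet v = ((G.neighborFinset v).image φ : Finset ℕ) := by
    simp
  rw [h1, h2, Set.ncard_coe_finset]
  exact Finset.card_le_card (Finset.image_subset_image (h.sub v))

lemma exists_good (hmin : ProperSubgraphsCh3dLE G 6) (hL : ∀ v, 6 ≤ (L v).card)
    (S : Finset V) (hS : S.Nonempty)
    (h1 : ∀ v ∈ S, ∀ a b, G.Adj v a → G.Adj v b → a ∉ S → b ∉ S → a = b) :
    ∃ T φ, Dyn3Good G L T S φ ∧
      ∀ v, 3 ≤ (G.neighborFinset v \ S).card → Disjoint (T v) S := by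
  let H : G.Subgraph := (⊤ : G.Subgraph).deleteVerts S
  have hHv : ∀ v, v ∈ H.verts ↔ v ∉ S := by intro v; simp [H]
  have hH : H ≠ ⊤ := by
    obtain ⟨s, hs⟩ := hS
    intro h
    have := hHv s
    simp [h, hs] at this
  obtain ⟨φ₀, ⟨hp, hd⟩, hl⟩ := hmin H hH (fun v => L v) (fun v => hL v)
  let φ : V → ℕ := fun v => if hv : v ∉ S then φ₀ ⟨v, (hHv v).2 hv⟩ else 0
  have hφ : ∀ v : H.verts, φ v = φ₀ v := by
    intro v; simp only [φ]; rw [dif_pos ((hHv v).1 v.2)]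
  have hadj : ∀ u v : H.verts, H.coe.Adj u v ↔ G.Adj u v := by
    intro u v
    have hu := (hHv u).1 u.2
    have hv := (hHv v).1 v.2
    simp [H, hu, hv]
  have key : ∀ v, min 3 (G.neighborFinset v \ S).card ≤ ((G.neighborFinset v \ S).image φ).card := by
    intro v
    by_cases hv : v ∈ S
    · have : (G.neighborFinset v \ S).card ≤ 1 := by
        rw [Finset.card_le_one]
        intro a ha b hb
        simp at ha hb
        exact h1 v hv a b ha.1 hb.1 ha.2 hb.2
      rcases Finset.eq_empty_or_nonempty (G.neighborFinset v \ S) with he | he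
      · simp [he]
      · have := (he.image φ).card_pos
        omega
    · have := hd ⟨v, (hHv v).2 hv⟩
      have e1 : ((Subtype.val : H.verts → V) '' (H.coe.neighborSet ⟨v, (hHv v).2 hv⟩))
          = (G.neighborFinset v \ S : Finset V) := by
        ext a
        constructor
        · rintro ⟨b, hb, rfl⟩
          have hb' := (hadj _ _).1 hb
          simpa using ⟨hb', (hHv b).1 b.2⟩
        · intro ha
          simp at ha
          exact ⟨⟨a, (hHv a).2 ha.2⟩, (hadj _ _).2 ha.1, rfl⟩
      have e2 : φ₀ '' (H.coe.neighborSet ⟨v, (hHv v).2 hv⟩)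
          = ((G.neighborFinset v \ S).image φ : Finset ℕ) := by
        rw [Finset.coe_image, ← e1, Set.image_image]
        exact Set.image_congr fun a _ => (hφ a).symm
      rw [e2, Set.ncard_coe_finset, ← Set.ncard_image_of_injective _ Subtype.val_injective, e1,
        Set.ncard_coe_finset] at this
      exact this
  choose T hT1 hT2 hT3 hT4 using fun v => aux_T (G.neighborFinset v) S φ (key v)
  refine ⟨T, φ, ⟨hT1, hT2, ?_, ?_, ?_⟩, hT4⟩
  · intro v a b ha hb ha' hb' hab
    exact hT3 v (by simp [ha, ha']) (by simp [hb, hb']) hab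
  · intro a b ha hb hab
    have := hp ⟨a, (hHv a).2 ha⟩ ⟨b, (hHv b).2 hb⟩ ((hadj _ _).2 hab)
    rwa [← hφ, ← hφ] at this
  · intro a ha
    have := hl ⟨a, (hHv a).2 ha⟩
    rwa [← hφ] at this

structure Conf (G : SimpleGraph V) (x : V) (w y : Fin 3 → V) : Prop where
  winj : Function.Injective w
  nx : ∀ v, G.Adj x v ↔ ∃ i, v = w i
  nw : ∀ i v, G.Adj (w i) v ↔ v = x ∨ v = y i
  yx : ∀ i, y i ≠ x

/-- the K4 vertices -/
def kv (x : V) (w : Fin 3 → V) : Option (Fin 3) → V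
  | none => x
  | some i => w i

/-- the K4 vertex set -/
def KS (x : V) (w : Fin 3 → V) : Finset V := Finset.univ.image (kv x w)

lemma mem_KS {x : V} {w : Fin 3 → V} {v : V} : v ∈ KS x w ↔ v = x ∨ ∃ i, v = w i := by
  simp [KS, kv, Option.exists, eq_comm]

lemma k4stage {x : V} {w y : Fin 3 → V} (C : Conf G x w y) (hL : ∀ v, 6 ≤ (L v).card)
    (hG : ¬ Dyn3ListColorable G L) {ψ : V → ℕ} (h : Dyn3Good G L T (KS x w) ψ)
    (Fx : Finset ℕ) (Fw : Fin 3 → Finset ℕ) (hFx : Fx.card ≤ 3) (hFw : ∀ i, (Fw i).card ≤ 3)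
    (h1 : ∀ i, y i ∉ KS x w → ψ (y i) ∈ Fx) (h2 : ∀ i, y i ∉ KS x w → ψ (y i) ∈ Fw i)
    (h3 : ∀ i b, w i ∈ T (y i) → b ∈ T (y i) → b ≠ w i → b ∉ KS x w → ψ b ∈ Fw i) :
    ∃ U : Finset ℕ, U.card = 3 ∧ L x \ Fx = U ∧ ∀ i, L (w i) \ Fw i = U := by
  have hxw : ∀ i, x ≠ w i := fun i => ((C.nx _).2 ⟨i, rfl⟩).ne
  have kinj : Function.Injective (kv x w) := by
    rintro (_ | i) (_ | j) hij
    · rfl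
    · exact absurd hij (hxw j)
    · exact absurd hij.symm (hxw i)
    · exact congrArg some (C.winj hij)
  let F : Option (Fin 3) → Finset ℕ := fun o => o.elim Fx Fw
  have hno : ¬ ∃ c : Option (Fin 3) → ℕ, Function.Injective c ∧
      ∀ o, c o ∈ L (kv x w o) \ F o := by
    rintro ⟨c, cinj, hc⟩
    apply hG
    let ψ' := Function.extend (kv x w) c ψ
    have e1 : ∀ o, ψ' (kv x w o) = c o := fun o => kinj.extend_apply _ _ _
    have e2 : ∀ v, v ∉ KS x w → ψ' v = ψ v := by
      intro v hv
      apply Function.extend_apply'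
      rintro ⟨o, rfl⟩
      exact hv (by simp [KS])
    have e3 : ∀ v, v ∈ KS x w → ∃ o, v = kv x w o := by
      intro v hv; simp [KS] at hv; obtain ⟨o, ho⟩ := hv; exact ⟨o, ho.symm⟩
    have m : ∀ v, (∃ i, v = w i) → v ∈ KS x w := fun v hv => mem_KS.2 (Or.inr hv)
    have mx : x ∈ KS x w := mem_KS.2 (Or.inl rfl)
    have kk : ∀ a b, a ∈ KS x w → b ∈ KS x w → ψ' a = ψ' b → a = b := by
      intro a b ha hb hab
      obtain ⟨o, rfl⟩ := e3 a ha
      obtain ⟨o', rfl⟩ := e3 b hb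
      rw [e1, e1] at hab
      rw [cinj hab]
    have cF : ∀ o n, n ∈ F o → ψ' (kv x w o) ≠ n := by
      intro o n hn he
      rw [e1] at he
      exact (Finset.mem_sdiff.1 (hc o)).2 (he ▸ hn)
    have ko : ∀ a b, a ∈ KS x w → b ∉ KS x w →
        (G.Adj a b ∨ ∃ v, a ∈ T v ∧ b ∈ T v) → ψ' a ≠ ψ' b := by
      intro a b ha hb hab
      rw [e2 b hb]
      rcases mem_KS.1 ha with rfl | ⟨i, rfl⟩
      · apply cF none
        rcases hab with hab | ⟨v, hav, hbv⟩
        · exact absurd (m _ ((C.nx b).1 hab)) hb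
        · have := h.sub v hav
          rw [mem_neighborFinset, G.adj_comm] at this
          obtain ⟨i, rfl⟩ := (C.nx v).1 this
          have := h.sub _ hbv
          rw [mem_neighborFinset] at this
          rcases (C.nw i b).1 this with rfl | rfl
          · exact absurd mx hb
          · exact h1 i hb
      · apply cF (some i)
        rcases hab with hab | ⟨v, hav, hbv⟩
        · rcases (C.nw i b).1 hab with rfl | rfl
          · exact absurd mx hb
          · exact h2 i hb
        · have := h.sub v hav
          rw [mem_neighborFinset, G.adj_comm] at this
          rcases (C.nw i v).1 this with rfl | rfl
          · have := h.sub _ hbv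
            rw [mem_neighborFinset] at this
            exact absurd (m _ ((C.nx b).1 this)) hb
          · refine h3 i b hav hbv ?_ hb
            rintro rfl; exact hb ha
    apply Dyn3Good.colorable (T := T) (φ := ψ')
    refine ⟨h.sub, h.card, ?_, ?_, ?_⟩
    · intro v a b ha hb _ _ hab
      by_cases ha' : a ∈ KS x w <;> by_cases hb' : b ∈ KS x w
      · exact kk a b ha' hb' hab
      · exact absurd hab (ko a b ha' hb' (Or.inr ⟨v, ha, hb⟩))
      · exact absurd hab.symm (ko b a hb' ha' (Or.inr ⟨v, hb, ha⟩))
      · rw [e2 a ha', e2 b hb'] at hab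
        exact h.inj v a b ha hb ha' hb' hab
    · intro a b _ _ hadj hab
      by_cases ha' : a ∈ KS x w <;> by_cases hb' : b ∈ KS x w
      · exact hadj.ne (kk a b ha' hb' hab)
      · exact absurd hab (ko a b ha' hb' (Or.inl hadj))
      · exact absurd hab.symm (ko b a hb' ha' (Or.inl hadj.symm))
      · rw [e2 a ha', e2 b hb'] at hab
        exact h.proper a b ha' hb' hadj hab
    · intro a _
      by_cases ha' : a ∈ KS x w
      · obtain ⟨o, rfl⟩ := e3 a ha'
        rw [e1]
        exact (Finset.mem_sdiff.1 (hc o)).1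
      · rw [e2 a ha']; exact h.list a ha'
  obtain ⟨U, hU, hall⟩ := aux_sdr (by simp) (fun o => L (kv x w o) \ F o) (by
    intro o
    have h6 := hL (kv x w o)
    have h7 : (F o).card ≤ 3 := by
      cases o with
      | none => exact hFx
      | some i => exact hFw i
    have := Finset.le_card_sdiff (F o) (L (kv x w o))
    omega) hno
  exact ⟨U, hU, hall none, fun i => hall (some i)⟩

lemma card_F {A F : Finset ℕ} (hA : 6 ≤ A.card) (h : (A \ F).card = 3) : 3 ≤ F.card := by
  have := Finset.le_card_sdiff F A
  omega

lemma stageA {x : V} {w y : Fin 3 → V} (C : Conf G x w y) (hL : ∀ v, 6 ≤ (L v).card)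
    (hG : ¬ Dyn3ListColorable G L) (hmin : ProperSubgraphsCh3dLE G 6) :
    Function.Injective y ∧ (∀ i, y i ∉ KS x w) ∧ ∀ i, (G.neighborFinset (y i)).card = 3 := by
  have mw : ∀ i, w i ∈ KS x w := fun i => mem_KS.2 (Or.inr ⟨i, rfl⟩)
  have mx : x ∈ KS x w := mem_KS.2 (Or.inl rfl)
  obtain ⟨T, φ, h, hd⟩ := exists_good hmin hL (KS x w) ⟨x, mx⟩ (by
    intro v hv a b ha hb ha' hb'
    rcases mem_KS.1 hv with rfl | ⟨i, rfl⟩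
    · exact absurd (mem_KS.2 (Or.inr ((C.nx a).1 ha))) ha'
    · rcases (C.nw i a).1 ha with rfl | rfl
      · exact absurd mx ha'
      · rcases (C.nw i b).1 hb with rfl | rfl
        · exact absurd mx hb'
        · rfl)
  have hT3 : ∀ v, (T v).card ≤ 3 := fun v => by rw [h.card]; exact min_le_left _ _
  let P : Fin 3 → Finset V := fun i => if w i ∈ T (y i) then (T (y i)).erase (w i) else ∅
  have hP : ∀ i, (P i).card ≤ 2 := by
    intro i
    simp only [P]
    split_ifs with hi
    · rw [Finset.card_erase_of_mem hi]; have := hT3 (y i); omega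
    · simp
  have hy3 : (Finset.univ.image y).card ≤ 3 := by
    simpa using (Finset.card_image_le (s := (Finset.univ : Finset (Fin 3))) (f := y))
  have hc1 : (((Finset.univ.image y) \ KS x w).image φ).card ≤ ((Finset.univ.image y) \ KS x w).card :=
    Finset.card_image_le
  have hc2 : ((Finset.univ.image y) \ KS x w).card ≤ (Finset.univ.image y).card :=
    Finset.card_le_card Finset.sdiff_subset
  have hw1 : ∀ i, ((insert (y i) (P i) \ KS x w).image φ).card ≤ (P i).card + 1 := fun i =>
    Finset.card_image_le.trans ((Finset.card_le_card Finset.sdiff_subset).trans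
      (Finset.card_insert_le _ _))
  obtain ⟨U, hU, hx, hw⟩ := k4stage C hL hG h (((Finset.univ.image y) \ KS x w).image φ)
    (fun i => (insert (y i) (P i) \ KS x w).image φ) (by omega)
    (fun i => by have := hw1 i; have := hP i; omega)
    (fun i hi => Finset.mem_image_of_mem _ (by simp [hi]))
    (fun i hi => Finset.mem_image_of_mem _ (by simp [hi]))
    (fun i b hwi hb hne hbK => Finset.mem_image_of_mem _ (by simp [P, hwi, hb, hne, hbK]))
  have hx3 := card_F (hL x) (by rw [hx, hU])
  have hw3 := fun i => card_F (hL (w i)) (by rw [hw i, hU])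
  have yinj : Function.Injective y := by
    have : (Finset.univ.image y).card = (Finset.univ : Finset (Fin 3)).card := by
      simp; omega
    rw [Finset.card_image_iff] at this
    simpa [Set.injOn_univ] using this
  have yK : ∀ i, y i ∉ KS x w := by
    have he : (Finset.univ.image y) \ KS x w = Finset.univ.image y :=
      Finset.eq_of_subset_of_card_le Finset.sdiff_subset (by omega)
    intro i
    have : y i ∈ (Finset.univ.image y) \ KS x w := by rw [he]; simp
    exact (Finset.mem_sdiff.1 this).2
  refine ⟨yinj, yK, fun i => ?_⟩
  have h3 := hw3 i
  have h4 := hw1 i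
  have hwi : w i ∈ T (y i) := by
    by_contra hn
    have : (P i).card = 0 := by simp [P, hn]
    omega
  have h5 : (P i).card = (T (y i)).card - 1 := by simp [P, hwi]
  have h6 := h.card (y i)
  by_contra hne
  have hge : 4 ≤ (G.neighborFinset (y i)).card := by omega
  have hin : G.neighborFinset (y i) ∩ KS x w ⊆ {w i} := by
    intro v hv
    rw [Finset.mem_inter, mem_neighborFinset] at hv
    rcases mem_KS.1 hv.2 with rfl | ⟨j, rfl⟩
    · exact absurd (mem_KS.2 (Or.inr ((C.nx _).1 hv.1.symm))) (yK i)
    · rcases (C.nw j _).1 hv.1.symm with h' | h'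
      · exact absurd h' (C.yx i)
      · rw [yinj h']; simp
  have h7 := Finset.card_le_card hin
  have h8 := Finset.card_inter_add_card_sdiff (G.neighborFinset (y i)) (KS x w)
  rw [Finset.card_singleton] at h7
  have := hd (y i) (by omega)
  exact Finset.disjoint_left.1 this hwi (mw i)

lemma exists_color {A F : Finset ℕ} (h : F.card < A.card) : ∃ a ∈ A, a ∉ F := by
  by_contra hn
  push Not at hn
  have := Finset.card_le_card (show A ⊆ F from hn)
  omega

lemma stageB {x : V} {w y : Fin 3 → V} (C : Conf G x w y) (hL : ∀ v, 6 ≤ (L v).card)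
    (hG : ¬ Dyn3ListColorable G L) (hmin : ProperSubgraphsCh3dLE G 6)
    (yinj : Function.Injective y) (yK : ∀ i, y i ∉ KS x w)
    (y3 : ∀ i, (G.neighborFinset (y i)).card = 3) (i : Fin 3) (z : V) (hz : G.Adj (y i) z)
    (hzw : z ≠ w i) (hz2 : (G.neighborFinset z).card = 2) : False := by
  have mw : ∀ i, w i ∈ KS x w := fun i => mem_KS.2 (Or.inr ⟨i, rfl⟩)
  have mx : x ∈ KS x w := mem_KS.2 (Or.inl rfl)
  have ywadj : ∀ i, G.Adj (y i) (w i) := fun i => ((C.nw i _).2 (Or.inr rfl)).symm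
  have nyK : ∀ i v, G.Adj (y i) v → v ∈ KS x w → v = w i := by
    intro i v hv hK
    rcases mem_KS.1 hK with rfl | ⟨j, rfl⟩
    · exact absurd (mem_KS.2 (Or.inr ((C.nx _).1 hv.symm))) (yK i)
    · rcases (C.nw j _).1 hv.symm with h' | h'
      · exact absurd h' (C.yx i)
      · rw [yinj h']
  have zK : z ∉ KS x w := fun h => hzw (nyK i z hz h)
  have zy : ∀ j, z ≠ y j := by
    rintro j rfl
    have := y3 j
    omega
  -- the third neighbor of `y i`
  obtain ⟨t, ht⟩ : ∃ t, ((G.neighborFinset (y i)).erase (w i)).erase z = {t} := by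
    rw [← Finset.card_eq_one, Finset.card_erase_of_mem (by simp [hz, hzw]),
      Finset.card_erase_of_mem (by simp [ywadj i]), y3 i]
  have htm : t ≠ z ∧ t ≠ w i ∧ G.Adj (y i) t := by
    have : t ∈ ((G.neighborFinset (y i)).erase (w i)).erase z := by rw [ht]; simp
    simpa using this
  obtain ⟨htz, htw, hty⟩ := htm
  have ny : ∀ v, G.Adj (y i) v → v = w i ∨ v = z ∨ v = t := by
    intro v hv
    by_contra! hn
    have : v ∈ ({t} : Finset V) := by rw [← ht]; simp [hv, hn.1, hn.2.1]
    exact hn.2.2 (by simpa using this)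
  obtain ⟨z', hz'⟩ : ∃ z', (G.neighborFinset z).erase (y i) = {z'} := by
    rw [← Finset.card_eq_one, Finset.card_erase_of_mem (by simp [hz.symm]), hz2]
  have hzm : z' ≠ y i ∧ G.Adj z z' := by
    have : z' ∈ (G.neighborFinset z).erase (y i) := by rw [hz']; simp
    simpa using this
  obtain ⟨hz'y, hzz'⟩ := hzm
  have nz : ∀ v, G.Adj z v → v = y i ∨ v = z' := by
    intro v hv
    by_contra! hn
    have : v ∈ ({z'} : Finset V) := by rw [← hz']; simp [hv, hn.1]
    exact hn.2 (by simpa using this)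
  have tK : t ∉ KS x w := fun h => htw (nyK i t hty h)
  have z'K : z' ∉ KS x w := by
    intro h
    rcases mem_KS.1 h with rfl | ⟨j, rfl⟩
    · exact zK (mem_KS.2 (Or.inr ((C.nx _).1 hzz'.symm)))
    · rcases (C.nw j _).1 hzz'.symm with h' | h'
      · exact zK (h' ▸ mx)
      · exact zy j h'
  let S : Finset V := insert (y i) (insert z (KS x w))
  have mS : ∀ v, v ∉ S ↔ v ≠ y i ∧ v ≠ z ∧ v ∉ KS x w := by
    intro v; simp [S]
  have tS : t ∉ S := (mS t).2 ⟨hty.ne', htz, tK⟩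
  have z'S : z' ∉ S := (mS z').2 ⟨hz'y, hzz'.ne', z'K⟩
  obtain ⟨T, φ, h, -⟩ := exists_good hmin hL S ⟨z, by simp [S]⟩ (by
    intro v hv a b ha hb ha' hb'
    have haS := (mS a).1 ha'
    have hbS := (mS b).1 hb'
    simp only [S, Finset.mem_insert] at hv
    rcases hv with rfl | rfl | hv
    · have h1 : a = t := by
        rcases ny a ha with rfl | h1 | h1
        · exact absurd (mw i) haS.2.2
        · exact absurd h1 haS.2.1
        · exact h1
      have h2 : b = t := by
        rcases ny b hb with rfl | h1 | h1
        · exact absurd (mw i) hbS.2.2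
        · exact absurd h1 hbS.2.1
        · exact h1
      rw [h1, h2]
    · have h1 := (nz a ha).resolve_left haS.1
      have h2 := (nz b hb).resolve_left hbS.1
      rw [h1, h2]
    rcases mem_KS.1 hv with rfl | ⟨j, rfl⟩
    · exact absurd (mem_KS.2 (Or.inr ((C.nx a).1 ha))) haS.2.2
    · rcases (C.nw j a).1 ha with rfl | rfl
      · exact absurd mx haS.2.2
      · rcases (C.nw j b).1 hb with rfl | rfl
        · exact absurd mx hbS.2.2
        · rfl)
  have hT3 : ∀ v, (T v).card ≤ 3 := fun v => by rw [h.card]; exact min_le_left _ _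
  have hTy : ∀ j, T (y j) = G.neighborFinset (y j) := fun j => h.T_eq _ (y3 j).le
  let ψ : ℕ → ℕ → V → ℕ := fun α β => Function.update (Function.update φ (y i) α) z β
  have ψz : ∀ α β, ψ α β z = β := by intro α β; simp [ψ]
  have ψy : ∀ α β, ψ α β (y i) = α := by intro α β; simp [ψ, (zy i).symm]
  have ψo : ∀ α β v, v ≠ y i → v ≠ z → ψ α β v = φ v := by
    intro α β v h1 h2; simp [ψ, h1, h2]
  -- forbidden sets
  let Pt : Finset V := if y i ∈ T t then (T t).erase (y i) else ∅
  let Pz : Finset V := if z ∈ T z' then ((T z').erase z) \ S else ∅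
  let Fy : Finset ℕ := (insert t (insert z' Pt)).image φ
  let Fz : Finset ℕ := (insert t (insert z' Pz)).image φ
  have good : ∀ α β, α ∈ L (y i) → β ∈ L z → α ∉ Fy → β ∉ Fz → α ≠ β →
      Dyn3Good G L T (KS x w) (ψ α β) := by
    intro α β hα hβ hαF hβF hαβ
    have a1 : ∀ v, v ∈ insert t (insert z' Pt) → α ≠ φ v := by
      rintro v hv rfl; exact hαF (Finset.mem_image_of_mem _ hv)
    have b1 : ∀ v, v ∈ insert t (insert z' Pz) → β ≠ φ v := by
      rintro v hv rfl; exact hβF (Finset.mem_image_of_mem _ hv)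
    have kyz : ψ α β (y i) ≠ ψ α β z := by rw [ψy, ψz]; exact hαβ
    have ky : ∀ b, b ∉ S → (G.Adj (y i) b ∨ ∃ v, y i ∈ T v ∧ b ∈ T v) →
        ψ α β (y i) ≠ ψ α β b := by
      intro b hb hab
      have hbS := (mS b).1 hb
      rw [ψy, ψo _ _ b hbS.1 hbS.2.1]
      apply a1
      rcases hab with hab | ⟨v, hav, hbv⟩
      · rcases ny b hab with rfl | rfl | rfl
        · exact absurd (mw i) hbS.2.2
        · exact absurd rfl hbS.2.1
        · simp
      · have hv := h.sub v hav
        have hv' := h.sub v hbv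
        rw [mem_neighborFinset] at hv hv'
        rcases ny v hv.symm with rfl | rfl | rfl
        · rcases (C.nw i b).1 hv' with rfl | rfl
          · exact absurd mx hbS.2.2
          · exact absurd rfl hbS.1
        · rcases nz b hv' with rfl | rfl
          · exact absurd rfl hbS.1
          · simp
        · simp [Pt, hav, hbv, hbS.1]
    have kz : ∀ b, b ∉ S → (G.Adj z b ∨ ∃ v, z ∈ T v ∧ b ∈ T v) →
        ψ α β z ≠ ψ α β b := by
      intro b hb hab
      have hbS := (mS b).1 hb
      rw [ψz, ψo _ _ b hbS.1 hbS.2.1]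
      apply b1
      rcases hab with hab | ⟨v, hav, hbv⟩
      · rcases nz b hab with rfl | rfl
        · exact absurd rfl hbS.1
        · simp
      · have hv := h.sub v hav
        have hv' := h.sub v hbv
        rw [mem_neighborFinset] at hv hv'
        rcases nz v hv.symm with rfl | rfl
        · rcases ny b hv' with rfl | rfl | rfl
          · exact absurd (mw i) hbS.2.2
          · exact absurd rfl hbS.2.1
          · simp
        · simp [Pz, hav, hbv, hbS.2.1, hb]
    have main : ∀ a b, a ≠ b → a ∉ KS x w → b ∉ KS x w → (a ∉ S → b ∉ S → φ a ≠ φ b) →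
        (G.Adj a b ∨ ∃ v, a ∈ T v ∧ b ∈ T v) → ψ α β a ≠ ψ α β b := by
      intro a b hne ha hb hφ hab
      have hba : G.Adj b a ∨ ∃ v, b ∈ T v ∧ a ∈ T v := by
        rcases hab with hab | ⟨v, h1, h2⟩
        · exact Or.inl hab.symm
        · exact Or.inr ⟨v, h2, h1⟩
      by_cases ha1 : a = y i
      · subst ha1
        by_cases hb1 : b = z
        · subst hb1; exact kyz
        · exact ky b ((mS b).2 ⟨hne.symm, hb1, hb⟩) hab
      by_cases ha2 : a = z
      · subst ha2
        by_cases hb1 : b = y i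
        · subst hb1; exact kyz.symm
        · exact kz b ((mS b).2 ⟨hb1, hne.symm, hb⟩) hab
      have haS := (mS a).2 ⟨ha1, ha2, ha⟩
      by_cases hb1 : b = y i
      · subst hb1; exact (ky a haS hba).symm
      by_cases hb2 : b = z
      · subst hb2; exact (kz a haS hba).symm
      rw [ψo _ _ _ ha1 ha2, ψo _ _ _ hb1 hb2]
      exact hφ haS ((mS b).2 ⟨hb1, hb2, hb⟩)
    refine ⟨h.sub, h.card, ?_, ?_, ?_⟩
    · intro v a b ha hb ha' hb' hab
      by_contra hne
      exact main a b hne ha' hb' (fun h1 h2 h3 => hne (h.inj v a b ha hb h1 h2 h3))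
        (Or.inr ⟨v, ha, hb⟩) hab
    · intro a b ha hb hab
      exact main a b hab.ne ha hb (fun h1 h2 => h.proper a b h1 h2 hab) (Or.inl hab)
    · intro a ha
      by_cases ha1 : a = y i
      · rw [ha1, ψy]; exact hα
      by_cases ha2 : a = z
      · rw [ha2, ψz]; exact hβ
      rw [ψo _ _ _ ha1 ha2]
      exact h.list a ((mS a).2 ⟨ha1, ha2, ha⟩)
  have k4 : ∀ α β, α ∈ L (y i) → β ∈ L z → α ∉ Fy → β ∉ Fz → α ≠ β →
      ∃ U : Finset ℕ, U.card = 3 ∧ L x \ (Finset.univ.image y).image (ψ α β) = U ∧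
        ∀ j, L (w j) \ (insert (y j) ((G.neighborFinset (y j)).erase (w j))).image (ψ α β) = U := by
    intro α β hα hβ hαF hβF hαβ
    refine k4stage C hL hG (good α β hα hβ hαF hβF hαβ) _ _ ?_ ?_ ?_ ?_ ?_
    · refine Finset.card_image_le.trans (Finset.card_image_le.trans ?_)
      simp
    · intro j
      refine Finset.card_image_le.trans ((Finset.card_insert_le _ _).trans ?_)
      rw [Finset.card_erase_of_mem (by simp [ywadj j]), y3 j]
    · intro j _; exact Finset.mem_image_of_mem _ (by simp)
    · intro j _; exact Finset.mem_image_of_mem _ (by simp)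
    · intro j b _ hb hne _
      rw [hTy, mem_neighborFinset] at hb
      exact Finset.mem_image_of_mem _ (by simp [hb, hne])
  have hPt : Pt.card ≤ 2 := by
    simp only [Pt]
    split_ifs with hi
    · rw [Finset.card_erase_of_mem hi]; have := hT3 t; omega
    · simp
  have hPz : Pz.card ≤ 2 := by
    simp only [Pz]
    split_ifs with hi
    · refine (Finset.card_le_card Finset.sdiff_subset).trans ?_
      rw [Finset.card_erase_of_mem hi]; have := hT3 z'; omega
    · simp
  have c2 : ∀ P : Finset V, ((insert t (insert z' P)).image φ).card ≤ P.card + 2 := by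
    intro P
    have := Finset.card_insert_le z' P
    have := Finset.card_insert_le t (insert z' P)
    have : ((insert t (insert z' P)).image φ).card ≤ _ := Finset.card_image_le
    omega
  have hFy : Fy.card ≤ 4 := (c2 Pt).trans (by omega)
  have hFz : Fz.card ≤ Pz.card + 2 := c2 Pz
  have hLy := hL (y i)
  have hLz := hL z
  obtain ⟨α₁, hα₁, hα₁F⟩ := exists_color (A := L (y i)) (F := Fy) (by omega)
  obtain ⟨β₁, hβ₁, hβ₁F⟩ := exists_color (A := L z) (F := insert α₁ Fz) (by
    have := Finset.card_insert_le α₁ Fz; omega)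
  rw [Finset.mem_insert, not_or] at hβ₁F
  obtain ⟨U₁, hU₁, hx₁, hw₁⟩ := k4 α₁ β₁ hα₁ hβ₁ hα₁F hβ₁F.2 (Ne.symm hβ₁F.1)
  -- choose `j`
  obtain ⟨j, hji, hjt⟩ : ∃ j, j ≠ i ∧ y j ≠ t := by
    by_contra! hn
    have e1 : i + 1 ≠ i := (by decide : ∀ i : Fin 3, i + 1 ≠ i) i
    have e2 : i + 2 ≠ i := (by decide : ∀ i : Fin 3, i + 2 ≠ i) i
    have e3 : i + 1 ≠ i + 2 := (by decide : ∀ i : Fin 3, i + 1 ≠ i + 2) i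
    exact e3 (yinj ((hn _ e1).trans (hn _ e2).symm))
  have hjy : y j ≠ y i := fun h => hji (yinj h)
  have hnadj : ¬ G.Adj (y j) (y i) := by
    intro hadj
    rcases ny _ hadj.symm with h' | h' | h'
    · exact yK j (h' ▸ mw i)
    · exact zy j h'.symm
    · exact hjt h'
  by_cases hzj : G.Adj (y j) z
  · -- `z' = y j`
    have hz'j : z' = y j := ((nz _ hzj.symm).resolve_left hjy).symm
    have hzw' : z ≠ w j := fun h' => zK (h' ▸ mw j)
    have hQ : (((G.neighborFinset (y j)).erase (w j)).erase z).card = 1 := by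
      rw [Finset.card_erase_of_mem (by simp [hzj, hzw']),
        Finset.card_erase_of_mem (by simp [ywadj j]), y3 j]
    have hPz1 : Pz.card ≤ 1 := by
      rw [← hQ]
      apply Finset.card_le_card
      intro v hv
      simp only [Pz, hz'j, hTy] at hv
      rw [if_pos (by simpa using hzj)] at hv
      rw [Finset.mem_sdiff, mS, Finset.mem_erase] at hv
      simp only [Finset.mem_erase]
      exact ⟨hv.1.1, fun h' => hv.2.2.2 (h' ▸ mw j), hv.1.2⟩
    obtain ⟨β₂, hβ₂, hβ₂F⟩ := exists_color (A := L z) (F := insert β₁ (insert α₁ Fz)) (by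
      have := Finset.card_insert_le α₁ Fz
      have := Finset.card_insert_le β₁ (insert α₁ Fz)
      omega)
    simp only [Finset.mem_insert, not_or] at hβ₂F
    obtain ⟨U₂, hU₂, hx₂, hw₂⟩ := k4 α₁ β₂ hα₁ hβ₂ hα₁F hβ₂F.2.2 (Ne.symm hβ₂F.2.1)
    have hUU : U₁ = U₂ := by
      rw [← hx₁, ← hx₂]
      congr 1
      apply Finset.image_congr
      intro v hv
      have hv : ∃ k, y k = v := by simpa using hv
      obtain ⟨k, rfl⟩ := hv
      by_cases hk : y k = y i
      · rw [hk, ψy, ψy]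
      · rw [ψo _ _ _ hk (zy k).symm, ψo _ _ _ hk (zy k).symm]
    let P : Finset ℕ := (insert (y j) (((G.neighborFinset (y j)).erase (w j)).erase z)).image φ
    have hP : P.card ≤ 2 := Finset.card_image_le.trans ((Finset.card_insert_le _ _).trans (by omega))
    have e : ∀ β, (insert (y j) ((G.neighborFinset (y j)).erase (w j))).image (ψ α₁ β)
        = insert β P := by
      intro β
      have e0 : insert (y j) ((G.neighborFinset (y j)).erase (w j))
          = insert z (insert (y j) (((G.neighborFinset (y j)).erase (w j)).erase z)) := by
        rw [Finset.insert_comm, Finset.insert_erase]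
        simp [hzj, hzw']
      rw [e0, Finset.image_insert, ψz]
      congr 1
      apply Finset.image_congr
      intro v hv
      simp only [Finset.mem_coe, Finset.mem_insert, Finset.mem_erase, mem_neighborFinset] at hv
      apply ψo
      · rintro rfl
        rcases hv with hv | hv
        · exact hjy hv.symm
        · exact hnadj hv.2.2
      · rintro rfl
        rcases hv with hv | hv
        · exact zy j hv
        · exact hv.1 rfl
    have f1 := hw₁ j
    have f2 := hw₂ j
    rw [e] at f1 f2
    exact aux_toggle (L (w j)) P (hL _) hP β₁ β₂ (Ne.symm hβ₂F.1) (by rw [f1, hU₁])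
      (by rw [f1, f2, hUU])
  · obtain ⟨α₂, hα₂, hα₂F⟩ := exists_color (A := L (y i)) (F := insert α₁ Fy) (by
      have := Finset.card_insert_le α₁ Fy; omega)
    rw [Finset.mem_insert, not_or] at hα₂F
    obtain ⟨β₂, hβ₂, hβ₂F⟩ := exists_color (A := L z) (F := insert α₂ Fz) (by
      have := Finset.card_insert_le α₂ Fz; omega)
    rw [Finset.mem_insert, not_or] at hβ₂F
    obtain ⟨U₂, hU₂, hx₂, hw₂⟩ := k4 α₂ β₂ hα₂ hβ₂ hα₂F.2 hβ₂F.2 (Ne.symm hβ₂F.1)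
    have hUU : U₁ = U₂ := by
      rw [← hw₁ j, ← hw₂ j]
      congr 1
      apply Finset.image_congr
      intro v hv
      simp only [Finset.mem_coe, Finset.mem_insert, Finset.mem_erase, mem_neighborFinset] at hv
      have v1 : v ≠ y i := by
        rintro rfl
        rcases hv with hv | hv
        · exact hjy hv.symm
        · exact hnadj hv.2
      have v2 : v ≠ z := by
        rintro rfl
        rcases hv with hv | hv
        · exact zy j hv
        · exact hzj hv.2
      rw [ψo _ _ _ v1 v2, ψo _ _ _ v1 v2]
    let P : Finset ℕ := ((Finset.univ.image y).erase (y i)).image φ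
    have hP : P.card ≤ 2 := by
      refine Finset.card_image_le.trans ?_
      rw [Finset.card_erase_of_mem (by simp), Finset.card_image_of_injective _ yinj]
      simp
    have e : ∀ α β, (Finset.univ.image y).image (ψ α β) = insert α P := by
      intro α β
      have e0 : Finset.univ.image y = insert (y i) ((Finset.univ.image y).erase (y i)) := by
        rw [Finset.insert_erase]; simp
      rw [e0, Finset.image_insert, ψy]
      congr 1
      apply Finset.image_congr
      intro v hv
      have hv' : (∃ k, y k = v) ∧ v ≠ y i := by simpa using hv
      obtain ⟨⟨k, rfl⟩, hv1⟩ := hv'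
      exact ψo _ _ _ hv1 (zy k).symm
    rw [e] at hx₁ hx₂
    exact aux_toggle (L x) P (hL _) hP α₁ α₂ (Ne.symm hα₂F.1) (by rw [hx₁, hU₁])
      (by rw [hx₁, hx₂, hUU])

lemma conf_exists {x : V} (hx : Wmem G 3 x) : ∃ w y, Conf G x w y ∧
    ∀ i, (G.neighborFinset (w i)).card = 2 := by
  obtain ⟨h1, h2⟩ := hx
  have hsub : {y | G.Adj x y ∧ (G.neighborSet y).ncard = 2} ⊆ G.neighborSet x := fun v hv => hv.1
  have heq := Set.eq_of_subset_of_ncard_le hsub (by rw [h1, h2])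
  have hdeg : ∀ v, G.Adj x v → (G.neighborFinset v).card = 2 := by
    intro v hv
    have : v ∈ {y | G.Adj x y ∧ (G.neighborSet y).ncard = 2} := by rw [heq]; exact hv
    rw [← ncard_nbr]; exact this.2
  rw [ncard_nbr] at h1
  let e := (Finset.equivFinOfCardEq h1).symm
  have hw : ∀ i, G.Adj x (e i) := fun i => (mem_neighborFinset _ _ _).1 (e i).2
  have hy : ∀ i, ∃ y, (G.neighborFinset (e i : V)).erase x = {y} := by
    intro i
    rw [← Finset.card_eq_one, Finset.card_erase_of_mem (by simpa using (hw i).symm), hdeg _ (hw i)]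
  choose y hy using hy
  have hy' : ∀ i v, v = y i ↔ v ≠ x ∧ G.Adj (e i) v := by
    intro i v
    rw [← mem_neighborFinset, ← Finset.mem_erase, hy, Finset.mem_singleton]
  refine ⟨fun i => e i, y, ⟨fun i j hij => e.injective (Subtype.ext hij), ?_, ?_, ?_⟩,
    fun i => hdeg _ (hw i)⟩
  · intro v
    constructor
    · intro hv
      exact ⟨e.symm ⟨v, by simpa using hv⟩, by simp⟩
    · rintro ⟨i, rfl⟩; exact hw i
  · intro i v
    rw [hy']
    by_cases hv : v = x
    · subst hv; simpa using (hw i).symm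
    · simp [hv]
  · intro i
    exact ((hy' i _).1 rfl).1

end Aux

theorem min_counterexample_W3_weak_neighbors_in_W1 {V : Type*} [Fintype V]
    (G : SimpleGraph V) (hmad : MadLT G (18 / 7)) (hG : ¬ Ch3dLE G 6)
    (hmin : ProperSubgraphsCh3dLE G 6) :
    ∀ x : V, Wmem G 3 x →
      (∀ y : V, WeakAdj G x y → Wmem G 1 y) ∧
      ∃ y₁ y₂ y₃ : V, y₁ ≠ y₂ ∧ y₁ ≠ y₃ ∧ y₂ ≠ y₃ ∧
        WeakAdj G x y₁ ∧ WeakAdj G x y₂ ∧ WeakAdj G x y₃ ∧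
        Wmem G 1 y₁ ∧ Wmem G 1 y₂ ∧ Wmem G 1 y₃ := by

  classical
  intro x hx
  obtain ⟨w, y, C, hw2⟩ := conf_exists hx
  have hG' : ∃ L : V → Finset ℕ, (∀ v, 6 ≤ (L v).card) ∧ ¬ Dyn3ListColorable G L := by
    unfold Ch3dLE at hG
    push Not at hG
    exact hG
  obtain ⟨L, hL, hno⟩ := hG'
  obtain ⟨yinj, yK, y3⟩ := stageA C hL hno hmin
  have hW : ∀ i, Wmem G 1 (y i) := by
    intro i
    refine ⟨by rw [ncard_nbr, y3 i], ?_⟩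
    rw [Set.ncard_eq_one]
    refine ⟨w i, ?_⟩
    ext z
    simp only [Set.mem_ofPred_eq, Set.mem_singleton_iff]
    constructor
    · rintro ⟨hz, hz2⟩
      by_contra hne
      rw [ncard_nbr] at hz2
      exact stageB C hL hno hmin yinj yK y3 i z hz hne hz2
    · rintro rfl
      exact ⟨((C.nw i _).2 (Or.inr rfl)).symm, by rw [ncard_nbr, hw2]⟩
  have hwk : ∀ i, WeakAdj G x (y i) := fun i =>
    ⟨(C.yx i).symm, w i, (C.nx _).2 ⟨i, rfl⟩, ((C.nw i _).2 (Or.inr rfl)).symm,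
      by rw [ncard_nbr, hw2]⟩
  refine ⟨?_, y 0, y 1, y 2, yinj.ne (by decide), yinj.ne (by decide), yinj.ne (by decide),
    hwk 0, hwk 1, hwk 2, hW 0, hW 1, hW 2⟩
  rintro v ⟨hne, u, hxu, hvu, -⟩
  obtain ⟨i, rfl⟩ := (C.nx u).1 hxu
  rcases (C.nw i v).1 hvu.symm with h | h
  · exact absurd h.symm hne
  · rw [h]; exact hW i
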